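/- Let G be a connected bipartite graph with both parts nonempty, minimum degree at least 3, girth 2n, and diameter n (for some n ≥ 2), i.e. a generalized n-gon. Then for any two vertices x, y at distance exactly n, there exist at least two internally disjoint paths of length n from x to y. -/

import Mathlib

namespace SimpleGraph

variable {V : Type*} {G : SimpleGraph V}

/-- Two distinct paths with the same endpoints contain a cycle in their union, so the girth is at
most the sum of their lengths. -/
theorem Walk.IsPath.egirth_le_length_add_length {u v : V} {p q : G.Walk u v}
    (hp : p.IsPath) (hq : q.IsPath) (hne : p ≠ q) :
    G.egirth ≤ (p.length + q.length : ℕ) := by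
  classical
  let H : SimpleGraph V := fromEdgeSet {e | e ∈ p.edges ∨ e ∈ q.edges}
  have hH : H ≤ G := by
    intro a b hab
    rcases (fromEdgeSet_adj _).mp hab with ⟨h | h, -⟩
    · exact p.adj_of_mem_edges h
    · exact q.adj_of_mem_edges h
  have hmem : ∀ e, e ∈ H.edgeSet → e ∈ p.edges ++ q.edges := by
    intro e he
    rw [edgeSet_fromEdgeSet] at he
    exact List.mem_append.mpr he.1
  have hpH : ∀ e ∈ p.edges, e ∈ H.edgeSet := fun e he ↦ by
    rw [edgeSet_fromEdgeSet]
    exact ⟨Or.inl he, G.not_isDiag_of_mem_edgeSet (p.edges_subset_edgeSet he)⟩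
  have hqH : ∀ e ∈ q.edges, e ∈ H.edgeSet := fun e he ↦ by
    rw [edgeSet_fromEdgeSet]
    exact ⟨Or.inr he, G.not_isDiag_of_mem_edgeSet (q.edges_subset_edgeSet he)⟩
  have hcyc : ¬ H.IsAcyclic := by
    intro hac
    have h := congrArg (fun r : H.Path u v ↦ r.1.support)
      ((hac.subsingleton_path u v).elim ⟨_, hp.transfer hpH⟩ ⟨_, hq.transfer hqH⟩)
    simp only [Walk.support_transfer] at h
    exact hne (Walk.ext_support h)
  simp only [IsAcyclic, not_forall, not_not] at hcyc
  obtain ⟨a, w, hw⟩ := hcyc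
  have hlen : w.length ≤ p.length + q.length := by
    rw [← w.length_edges, ← p.length_edges, ← q.length_edges, ← List.length_append]
    exact (hw.isTrail.edges_nodup.subperm
      fun e he ↦ hmem e (w.edges_subset_edgeSet he)).length_le
  calc G.egirth ≤ (w.mapLe hH).length := egirth_le_length (hw.mapLe hH)
    _ ≤ (p.length + q.length : ℕ) := by
      rw [Walk.length_mapLe]
      exact_mod_cast hlen

/-- In a connected bipartite graph, the distances from two adjacent vertices to a third one
differ. -/
theorem Coloring.dist_ne_dist_of_adj (c : G.Coloring Bool) (hconn : G.Connected) {u v : V}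
    (huv : G.Adj u v) (w : V) : G.dist u w ≠ G.dist v w := by
  intro h
  obtain ⟨p, hp⟩ := hconn.exists_walk_length_eq_dist u w
  obtain ⟨q, hq⟩ := hconn.exists_walk_length_eq_dist v w
  have hpc := c.even_length_iff_congr p
  have hqc := c.even_length_iff_congr q
  rw [hp, h, ← hq, hqc] at hpc
  have hc := c.valid huv
  cases hu : c u <;> cases hv : c v <;> cases hw : c w <;> simp_all

end SimpleGraph

open SimpleGraph in
/-- In a generalized n-gon (connected bipartite graph with both
parts nonempty, minimum degree ≥ 3, girth 2n, diameter n, n ≥ 2), any two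
vertices at distance exactly n are joined by at least two internally disjoint
paths of length n. -/
theorem stmt_1 {V : Type*} (G : SimpleGraph V) (n : ℕ) (hn : 2 ≤ n)
    (hconn : G.Connected)
    (c : V → Bool) (hbip : ∀ u v, G.Adj u v → c u ≠ c v)
    (hP : ∃ u, c u = true) (hL : ∃ u, c u = false)
    (hthick : ∀ v : V, ∃ a b d : V, a ≠ b ∧ a ≠ d ∧ b ≠ d ∧
      G.Adj v a ∧ G.Adj v b ∧ G.Adj v d)
    (hgirth : G.egirth = 2 * n)
    (hdiam : G.ediam = n)
    (x y : V) (hxy : G.dist x y = n) :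
    ∃ p q : G.Walk x y, p.IsPath ∧ q.IsPath ∧ p.length = n ∧ q.length = n ∧
      p ≠ q ∧ ∀ v : V, v ∈ p.support → v ∈ q.support → v = x ∨ v = y := by
  classical
  have hle : ∀ u v, G.dist u v ≤ n := fun u v ↦ by
    have h : G.edist u v ≤ n := hdiam ▸ edist_le_ediam
    rw [← (hconn u v).coe_dist_eq_edist] at h
    exact_mod_cast h
  have key : ∀ a (h : G.Adj x a), ∃ p : G.Walk x y, p.length = n ∧ p.snd = a := fun a h ↦ by
    obtain ⟨r, hr⟩ := hconn.exists_walk_length_eq_dist a y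
    have h₁ := Coloring.dist_ne_dist_of_adj (Coloring.mk c fun {u v} ↦ hbip u v) hconn h y
    have h₂ := hle a y
    have h₃ := dist_le (Walk.cons h r)
    rw [Walk.length_cons] at h₃
    exact ⟨Walk.cons h r, by rw [Walk.length_cons]; omega, by simp⟩
  obtain ⟨a, b, -, hab, -, -, hxa, hxb, -⟩ := hthick x
  obtain ⟨p, hp, hpa⟩ := key a hxa
  obtain ⟨q, hq, hqb⟩ := key b hxb
  have hpp := p.isPath_of_length_eq_dist (hp.trans hxy.symm)
  have hqp := q.isPath_of_length_eq_dist (hq.trans hxy.symm)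
  refine ⟨p, q, hpp, hqp, hp, hq, fun h ↦ hab (by rw [← hpa, ← hqb, h]), fun v hvp hvq ↦ ?_⟩
  by_contra! hv
  have hne : p.takeUntil v hvp ≠ q.takeUntil v hvq := fun h ↦ hab <| by
    rw [← hpa, ← hqb, ← Walk.snd_takeUntil hv.1 p hvp, h, Walk.snd_takeUntil hv.1 q hvq]
  have hg := (hpp.takeUntil hvp).egirth_le_length_add_length (hqp.takeUntil hvq) hne
  have hlt := Walk.length_takeUntil_lt_length hvp hv.2
  have hlt' := Walk.length_takeUntil_lt_length hvq hv.2
  rw [hgirth] at hg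
  have hg' : 2 * n ≤ (p.takeUntil v hvp).length + (q.takeUntil v hvq).length := by
    exact_mod_cast hg
  omega
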